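/- There is a universal constant c > 0 such that the following holds for all natural numbers N ≥ 1 and M ≥ 1. Suppose there exist a finite type Ω with a probability mass function μ, an encoding function enc : ({0,1}^N) → Ω → Fin M, and a decoding function dec : Fin N → Fin M → {0,1} such that for every string s ∈ {0,1}^N and every index i ∈ Fin N, μ{ω : dec(i)(enc(s)(ω)) = s_i} ≥ 2/3. Then M ≥ 2^{c·N}. -/

import Mathlib

open Finset in
/-- The generating function of the number of agreements with a fixed Boolean string. -/
lemma sum_two_pow_card_agree {ι : Type*} [Fintype ι] [DecidableEq ι] (d : ι → Bool) :
    ∑ s : ι → Bool, (2 : ℝ) ^ #{i | d i = s i} = 3 ^ Fintype.card ι := by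
  have h (s : ι → Bool) :
      (2 : ℝ) ^ #{i | d i = s i} = ∏ i, if d i = s i then (2 : ℝ) else 1 := by
    rw [prod_ite, prod_const, prod_const_one, mul_one]
  simp_rw [h]
  rw [← Fintype.prod_sum (fun i b => if d i = b then (2 : ℝ) else 1)]
  have h3 (i : ι) : ∑ b : Bool, (if d i = b then (2 : ℝ) else 1) = 3 := by
    cases d i <;> norm_num
  simp only [h3, prod_const, card_univ]

open Finset in
/-- If each of finitely many events has probability at least `q`, then some outcome lies in at
least a fraction `q` of them. -/
lemma PMF.exists_mul_card_le_card {Ω ι : Type*} [Finite Ω] [Fintype ι] (μ : PMF Ω)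
    (A : ι → Ω → Prop) [∀ i ω, Decidable (A i ω)] (q : ℝ)
    (h : ∀ i, q ≤ (μ.toOuterMeasure {ω | A i ω}).toReal) :
    ∃ ω, q * Fintype.card ι ≤ #{i | A i ω} := by
  have := Fintype.ofFinite Ω
  have hsum : ∑ ω, (μ ω).toReal = 1 := by
    have h_one := μ.tsum_coe
    rw [tsum_fintype] at h_one
    rw [← ENNReal.toReal_sum fun ω _ => μ.apply_ne_top ω, h_one, ENNReal.toReal_one]
  have hreal (i : ι) :
      (μ.toOuterMeasure {ω | A i ω}).toReal = ∑ ω, (μ ω).toReal * if A i ω then 1 else 0 := by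
    rw [PMF.toOuterMeasure_apply_fintype, ENNReal.toReal_sum]
    · refine sum_congr rfl fun ω _ => ?_
      by_cases hA : A i ω <;> simp [hA]
    · intro ω _
      by_cases hA : A i ω <;> simp [hA, μ.apply_ne_top]
  have hexp : q * Fintype.card ι ≤ ∑ ω, (μ ω).toReal * #{i | A i ω} := by
    calc q * Fintype.card ι = ∑ _i : ι, q := by simp [mul_comm]
      _ ≤ ∑ i, ∑ ω, (μ ω).toReal * if A i ω then 1 else 0 :=
        sum_le_sum fun i _ => (h i).trans_eq (hreal i)
      _ = ∑ ω, (μ ω).toReal * #{i | A i ω} := by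
        rw [sum_comm]
        refine sum_congr rfl fun ω _ => ?_
        rw [← mul_sum, sum_boole]
  by_contra! hlt
  obtain ⟨ω₀, h₀⟩ := μ.support_nonempty
  have hpos : 0 < (μ ω₀).toReal :=
    ENNReal.toReal_pos ((μ.mem_support_iff ω₀).1 h₀) (μ.apply_ne_top ω₀)
  have : ∑ ω, (μ ω).toReal * #{i | A i ω} < ∑ ω, (μ ω).toReal * (q * Fintype.card ι) :=
    sum_lt_sum (fun ω _ => mul_le_mul_of_nonneg_left (hlt ω).le ENNReal.toReal_nonneg)
      ⟨ω₀, mem_univ _, mul_lt_mul_of_pos_left (hlt ω₀) hpos⟩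
  rw [← sum_mul, hsum, one_mul] at this
  linarith

open Finset in
/-- A covering bound: if every Boolean string agrees with some codeword in at least a fraction `q`
of its coordinates, then there are at least `2 ^ (N + q * N) / 3 ^ N` codewords. -/
lemma two_rpow_le_card_mul_three_pow {N M : ℕ} (d : Fin M → Fin N → Bool) (q : ℝ)
    (h : ∀ s : Fin N → Bool, ∃ m, q * N ≤ #{i | d m i = s i}) :
    (2 : ℝ) ^ (N + q * N) ≤ M * 3 ^ N := by
  calc (2 : ℝ) ^ (N + q * N) = ∑ _s : Fin N → Bool, (2 : ℝ) ^ (q * N) := by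
        rw [Real.rpow_add two_pos, Real.rpow_natCast]
        simp
    _ ≤ ∑ s : Fin N → Bool, ∑ m, (2 : ℝ) ^ #{i | d m i = s i} := by
        refine sum_le_sum fun s _ => ?_
        obtain ⟨m, hm⟩ := h s
        calc (2 : ℝ) ^ (q * N) ≤ (2 : ℝ) ^ (#{i | d m i = s i} : ℝ) :=
              Real.rpow_le_rpow_of_exponent_le one_le_two hm
          _ = (2 : ℝ) ^ #{i | d m i = s i} := Real.rpow_natCast _ _
          _ ≤ _ := single_le_sum (f := fun m => (2 : ℝ) ^ #{i | d m i = s i})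
              (fun _ _ => by positivity) (mem_univ m)
    _ = M * 3 ^ N := by
        rw [sum_comm]
        simp [sum_two_pow_card_agree]

/-- Folklore communication-complexity bound (Lemma `cc-everybit`): if a (possibly
randomized) data structure with `M` possible values allows each bit of an arbitrary
`N`-bit string to be recovered with marginal probability at least `2/3`, then
`M ≥ 2^{cN}` for a universal constant `c > 0`. -/
theorem bit_recovery_lower_bound :
    ∃ c : ℝ, 0 < c ∧
      ∀ N M : ℕ, 1 ≤ N → 1 ≤ M →
        (∃ (Ω : Type) (_ : Finite Ω) (μ : PMF Ω)
          (enc : (Fin N → Bool) → Ω → Fin M) (dec : Fin N → Fin M → Bool),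
          ∀ (s : Fin N → Bool) (i : Fin N),
            (2 / 3 : ENNReal) ≤ μ.toOuterMeasure {ω | dec i (enc s ω) = s i}) →
        (2 : ℝ) ^ (c * N) ≤ (M : ℝ) := by
  refine ⟨5 / 3 - Real.logb 2 3, ?_, ?_⟩
  · have h : (3 : ℝ) * Real.logb 2 3 < 5 := by
      have h27 : (3 : ℝ) * Real.logb 2 3 = Real.logb 2 27 := by
        rw [show (27 : ℝ) = 3 ^ 3 by norm_num, Real.logb_pow]
        norm_num
      rw [h27, Real.logb_lt_iff_lt_rpow one_lt_two (by norm_num)]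
      norm_num
    linarith
  rintro N M - - ⟨Ω, _, μ, enc, dec, h⟩
  have hcover := two_rpow_le_card_mul_three_pow (fun m i => dec i m) (2 / 3) fun s => by
    obtain ⟨ω, hω⟩ := μ.exists_mul_card_le_card (fun i ω => dec i (enc s ω) = s i) (2 / 3)
      fun i => by
        have hne : μ.toOuterMeasure {ω | dec i (enc s ω) = s i} ≠ ⊤ := by
          rw [PMF.toOuterMeasure_apply]
          exact μ.tsum_coe_indicator_ne_top _
        simpa using ENNReal.toReal_mono hne (h s i)
    exact ⟨enc s ω, by simpa using hω⟩
  have h3 : (2 : ℝ) ^ (Real.logb 2 3 * N) = 3 ^ N := by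
    rw [Real.rpow_mul two_pos.le, Real.rpow_logb two_pos (by norm_num) (by norm_num),
      Real.rpow_natCast]
  rw [show (5 / 3 - Real.logb 2 3) * N = (N + 2 / 3 * N) - Real.logb 2 3 * N by ring,
    Real.rpow_sub two_pos, h3, div_le_iff₀ (by positivity)]
  exact hcover
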